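/- There is no divisible design Cayley graph with parameters (24, 6, 2, 1, 3, 8); that is, no simple graph on 24 vertices that is simultaneously a divisible design graph with parameters (24, 6, 2, 1, 3, 8) and a Cayley graph. -/

import Mathlib

/-- A divisible design graph (DDG) with parameters `(v, k, l1, l2, m, n)`:
a `k`-regular simple graph on `v = m * n` vertices whose vertex set can be partitioned
into `m` classes of size `n` such that two distinct vertices from the same class have
exactly `l1` common neighbours and two vertices from different classes have exactly `l2`
common neighbours. -/
def IsDDG {V : Type*} (Γ : SimpleGraph V) (v k l1 l2 m n : ℕ) : Prop :=
  Nat.card V = v ∧ v = m * n ∧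
  (∀ x : V, Nat.card {z : V // Γ.Adj x z} = k) ∧
  ∃ c : V → Fin m,
    (∀ i : Fin m, Nat.card {x : V // c x = i} = n) ∧
    (∀ x y : V, x ≠ y → c x = c y →
      Nat.card {z : V // Γ.Adj x z ∧ Γ.Adj y z} = l1) ∧
    (∀ x y : V, c x ≠ c y →
      Nat.card {z : V // Γ.Adj x z ∧ Γ.Adj y z} = l2)

/-- A simple graph is a Cayley graph if and only if its automorphism group contains a
subgroup acting regularly (sharply transitively) on the vertices. -/
def IsCayleyGraph {V : Type*} (Γ : SimpleGraph V) : Prop :=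
  ∃ H : Subgroup (Equiv.Perm V),
    (∀ g ∈ H, ∀ x y : V, Γ.Adj (g x) (g y) ↔ Γ.Adj x y) ∧
    ∀ x y : V, ∃! g : Equiv.Perm V, g ∈ H ∧ g x = y

open scoped Classical in
/-- The number of neighbours of `x` in the class `i` of the colouring `c`. -/
noncomputable def classDegree {V : Type*} [Fintype V] (Γ : SimpleGraph V) {m : ℕ}
    (c : V → Fin m) (x : V) (i : Fin m) : ℤ :=
  ∑ z, if Γ.Adj x z ∧ c z = i then 1 else 0

theorem natCard_subtype_eq_sum {V : Type*} [Fintype V] (p : V → Prop) [DecidablePred p] :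
    (Nat.card {z : V // p z} : ℤ) = ∑ z, if p z then 1 else 0 := by
  simp [Nat.card_eq_fintype_card, Fintype.card_subtype]

open scoped Classical in
theorem sum_classDegree {V : Type*} [Fintype V] (Γ : SimpleGraph V) {m : ℕ}
    (c : V → Fin m) (x : V) :
    ∑ i, classDegree Γ c x i = Nat.card {z : V // Γ.Adj x z} := by
  rw [natCard_subtype_eq_sum]
  unfold classDegree
  rw [Finset.sum_comm]
  refine Finset.sum_congr rfl fun z _ => ?_
  by_cases h : Γ.Adj x z <;> simp [h]

/-- Edges counted from class `i` to class `j` agree with those counted in reverse. -/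
theorem sum_classDegree_symm {V : Type*} [Fintype V] (Γ : SimpleGraph V) {m : ℕ}
    (c : V → Fin m) (i j : Fin m) :
    (∑ x, if c x = i then classDegree Γ c x j else 0) =
      ∑ x, if c x = j then classDegree Γ c x i else 0 := by
  classical
  have h : ∀ a b : Fin m, (∑ x, if c x = a then classDegree Γ c x b else 0) =
      ∑ x, ∑ z, if c x = a ∧ Γ.Adj x z ∧ c z = b then (1 : ℤ) else 0 := by
    intro a b
    refine Finset.sum_congr rfl fun x _ => ?_
    by_cases hx : c x = a <;> simp [hx, classDegree]
  rw [h, h, Finset.sum_comm]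
  refine Finset.sum_congr rfl fun x _ => Finset.sum_congr rfl fun z _ => ?_
  refine if_congr ?_ rfl rfl
  rw [Γ.adj_comm]
  tauto

/-- Automorphisms respecting the class partition preserve the number of neighbours
inside the own class. -/
theorem classDegree_self_map {V : Type*} [Fintype V] (Γ : SimpleGraph V) {m : ℕ}
    (c : V → Fin m) (g : Equiv.Perm V) (hadj : ∀ x y, Γ.Adj (g x) (g y) ↔ Γ.Adj x y)
    (hc : ∀ x y, c (g x) = c (g y) ↔ c x = c y) (x : V) :
    classDegree Γ c (g x) (c (g x)) = classDegree Γ c x (c x) := by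
  classical
  unfold classDegree
  rw [← Equiv.sum_comp g]
  exact Finset.sum_congr rfl fun z _ => if_congr (and_congr (hadj x z) (hc z x)) rfl rfl

/-- The identity `A K A = 12 K + 8 J`, where `A` is the adjacency matrix and `K` the matrix of
the relation of being in the same class. -/
theorem adjMatrix_mul_sameClass_mul {V : Type*} [Fintype V] [DecidableEq V]
    (A K J : Matrix V V ℤ) (hsq : A * A = 4 + K + J) (hK : K * K = 8 * K) (hKJ : K * J = 8 * J)
    (hJK : J * K = 8 * J) (hJ : J * J = 24 * J) (hAJ : A * J = 6 * J) (hJA : J * A = 6 * J) :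
    A * K * A = 12 * K + 8 * J := by
  have hK' : K = A * A - 4 - J := by rw [hsq]; abel
  have h4 : A * 4 = 4 * A := ((4 : ℕ).commute_cast A).eq
  have hK4 : K * 4 = 4 * K := ((4 : ℕ).commute_cast K).eq
  have hJ4 : J * 4 = 4 * J := ((4 : ℕ).commute_cast J).eq
  have hA6 : A * (6 * J) = 36 * J := by
    have : A * 6 = 6 * A := ((6 : ℕ).commute_cast A).eq
    rw [← mul_assoc, this, mul_assoc, hAJ, ← mul_assoc]; norm_num
  calc A * K * A = A * (A * A - 4 - J) * A := by rw [← hK']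
    _ = (A * A) * (A * A) - (A * 4) * A - A * (J * A) := by noncomm_ring
    _ = (4 + K + J) * (4 + K + J) - 4 * (4 + K + J) - 36 * J := by
      rw [h4, mul_assoc 4 A A, hsq, hJA, hA6]
    _ = 4 * K + 4 * J + K * K + K * J + J * K + J * J - 36 * J := by
      simp only [mul_add, add_mul, hK4, hJ4]; noncomm_ring
    _ = 12 * K + 8 * J := by rw [hK, hKJ, hJK, hJ]; noncomm_ring

theorem sum_classDegree_mul {V : Type*} [Fintype V] (Γ : SimpleGraph V)
    (c : V → Fin 3) (hV : Nat.card V = 24)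
    (hdeg : ∀ x : V, Nat.card {z : V // Γ.Adj x z} = 6)
    (hclass : ∀ i, Nat.card {x : V // c x = i} = 8)
    (hsame : ∀ x y : V, x ≠ y → c x = c y →
      Nat.card {z : V // Γ.Adj x z ∧ Γ.Adj y z} = 2)
    (hdiff : ∀ x y : V, c x ≠ c y →
      Nat.card {z : V // Γ.Adj x z ∧ Γ.Adj y z} = 1) (x y : V) :
    ∑ i, classDegree Γ c x i * classDegree Γ c y i = if c x = c y then 20 else 8 := by
  classical
  let A : Matrix V V ℤ := Matrix.of fun x y => if Γ.Adj x y then 1 else 0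
  let B : Matrix V (Fin 3) ℤ := Matrix.of fun x i => if c x = i then 1 else 0
  let K : Matrix V V ℤ := Matrix.of fun x y => if c x = c y then 1 else 0
  let J : Matrix V V ℤ := Matrix.of fun _ _ => 1
  have hnum : ∀ (n : ℕ) [n.AtLeastTwo] (M : Matrix V V ℤ) (a b : V),
      ((OfNat.ofNat n : Matrix V V ℤ) * M) a b = (OfNat.ofNat n : ℤ) * M a b := by
    intro n _ M a b
    rw [← Matrix.diagonal_ofNat, Matrix.diagonal_mul]
  have hA : A.transpose = A := by
    ext a b
    simp [A, Γ.adj_comm]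
  have hdegZ : ∀ a, ∑ z, (if Γ.Adj a z then (1 : ℤ) else 0) = 6 := fun a => by
    rw [← natCard_subtype_eq_sum, hdeg]; rfl
  have hclassZ : ∀ i, ∑ z, (if c z = i then (1 : ℤ) else 0) = 8 := fun i => by
    rw [← natCard_subtype_eq_sum, hclass]; rfl
  have hcard : (Fintype.card V : ℤ) = 24 := by
    rw [← Nat.card_eq_fintype_card, hV]; rfl
  have hsq : A * A = 4 + K + J := by
    ext a b
    have h1 : (A * A) a b = Nat.card {z : V // Γ.Adj a z ∧ Γ.Adj b z} := by
      rw [natCard_subtype_eq_sum, Matrix.mul_apply]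
      refine Finset.sum_congr rfl fun z _ => ?_
      simp only [A, Matrix.of_apply, Γ.adj_comm b z, ite_and, ite_mul, one_mul, zero_mul]
    have h4 : (4 : Matrix V V ℤ) a b = if a = b then 4 else 0 := by
      rw [← Matrix.diagonal_ofNat, Matrix.diagonal_apply]
    rw [h1, Matrix.add_apply, Matrix.add_apply, h4]
    simp only [K, J, Matrix.of_apply]
    by_cases hab : a = b
    · subst hab
      simp [hdeg, -Nat.card_eq_fintype_card]
    · by_cases hc : c a = c b
      · simp [hsame a b hab hc, hab, hc, -Nat.card_eq_fintype_card]
      · simp [hdiff a b hc, hab, hc, -Nat.card_eq_fintype_card]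
  have hBK : B * B.transpose = K := by
    ext a b
    simp [Matrix.mul_apply, B, K, eq_comm]
  have hAB : ∀ a i, (A * B) a i = classDegree Γ c a i := by
    intro a i
    rw [Matrix.mul_apply]
    refine Finset.sum_congr rfl fun z _ => ?_
    simp only [A, B, Matrix.of_apply]
    split_ifs <;> simp_all
  have hBB : B.transpose * B = 8 := by
    ext i j
    rw [← Matrix.diagonal_ofNat, Matrix.diagonal_apply, Matrix.mul_apply]
    simp only [B, Matrix.transpose_apply, Matrix.of_apply]
    by_cases hij : i = j
    · subst hij
      rw [if_pos rfl]
      refine (Finset.sum_congr rfl fun z _ => ?_).trans (hclassZ i)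
      split_ifs <;> norm_num
    · rw [if_neg hij]
      refine Finset.sum_eq_zero fun z _ => ?_
      split_ifs <;> simp_all
  have hK : K * K = 8 * K := by
    ext a b
    rw [hnum, ← hBK]
    have : B * B.transpose * (B * B.transpose) = B * (B.transpose * B) * B.transpose := by
      simp only [Matrix.mul_assoc]
    rw [this, hBB, ← Matrix.diagonal_ofNat, Matrix.mul_apply, Matrix.mul_apply, Finset.mul_sum]
    refine Finset.sum_congr rfl fun i _ => ?_
    rw [Matrix.mul_diagonal, mul_comm (B a i), mul_assoc]
  have hKJ : K * J = 8 * J := by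
    ext a b
    rw [hnum, Matrix.mul_apply]
    simpa [K, J, eq_comm] using hclassZ (c a)
  have hJK : J * K = 8 * J := by
    ext a b
    rw [hnum, Matrix.mul_apply]
    simpa [K, J] using hclassZ (c b)
  have hJ : J * J = 24 * J := by
    ext a b
    rw [hnum, Matrix.mul_apply]
    simpa [J] using hcard
  have hAJ : A * J = 6 * J := by
    ext a b
    rw [hnum, Matrix.mul_apply]
    simpa [A, J] using hdegZ a
  have hJA : J * A = 6 * J := by
    ext a b
    rw [hnum, Matrix.mul_apply]
    simpa [A, J, Γ.adj_comm] using hdegZ b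
  have key := congrFun (congrFun
    (adjMatrix_mul_sameClass_mul A K J hsq hK hKJ hJK hJ hAJ hJA) x) y
  have hfac : A * K * A = A * B * (A * B).transpose := by
    rw [Matrix.transpose_mul, hA, ← hBK]
    simp only [Matrix.mul_assoc]
  rw [hfac, Matrix.mul_apply, Matrix.add_apply, hnum, hnum] at key
  simp only [Matrix.transpose_apply, hAB] at key
  rw [key]
  simp only [K, J, Matrix.of_apply]
  split_ifs <;> norm_num

/-- Nonnegative integers with sum `6` and sum of squares `20` are `0, 2, 4` in some order. -/
theorem pairwise_ne_of_sum_six_of_sum_sq_twenty {a b d : ℤ} (ha : 0 ≤ a) (hb : 0 ≤ b)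
    (hd : 0 ≤ d) (hs : a + b + d = 6) (hq : a * a + b * b + d * d = 20) :
    a ≠ b ∧ a ≠ d ∧ b ≠ d ∧ (a = 0 ∨ a = 2 ∨ a = 4) ∧ (b = 0 ∨ b = 2 ∨ b = 4) ∧
      (d = 0 ∨ d = 2 ∨ d = 4) := by
  have ha' : a ≤ 6 := by linarith
  have hb' : b ≤ 6 := by linarith
  obtain rfl : d = 6 - a - b := by linarith
  interval_cases a <;> interval_cases b <;> simp_all

/-- There is no divisible design Cayley graph with parameters
`(24, 6, 2, 1, 3, 8)`. -/
theorem no_ddcg_24_6_2_1_3_8 :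
    ¬ ∃ (V : Type) (Γ : SimpleGraph V),
        IsDDG Γ 24 6 2 1 3 8 ∧ IsCayleyGraph Γ := by
  rintro ⟨V, Γ, ⟨hV, -, hdeg, c, hclass, hsame, hdiff⟩, H, hadj, htrans⟩
  have : Finite V := Nat.finite_of_card_ne_zero (by omega)
  have := Fintype.ofFinite V
  have hmul := sum_classDegree_mul Γ c hV hdeg hclass hsame hdiff
  have hsum : ∀ x, ∑ i, classDegree Γ c x i = 6 := fun x => by
    rw [sum_classDegree, hdeg]; rfl
  have hnonneg : ∀ x i, 0 ≤ classDegree Γ c x i := fun x i =>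
    Finset.sum_nonneg fun z _ => by split_ifs <;> norm_num
  have hequit : ∀ x y, c x = c y → ∀ i, classDegree Γ c x i = classDegree Γ c y i := by
    intro x y hxy i
    have h : ∑ i, (classDegree Γ c x i - classDegree Γ c y i) ^ 2 = 0 := by
      have h1 := hmul x x
      have h2 := hmul y y
      have h3 := hmul x y
      simp only [hxy, if_true, Fin.sum_univ_three] at h1 h2 h3 ⊢
      linarith
    have h' := (Finset.sum_eq_zero_iff_of_nonneg fun i _ => sq_nonneg _).1 h i (Finset.mem_univ i)
    exact sub_eq_zero.1 (pow_eq_zero_iff two_ne_zero |>.1 h')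
  have hrep : ∀ i, ∃ x, c x = i := fun i => by
    have : Nonempty {x : V // c x = i} := (Nat.card_pos_iff.1 (by rw [hclass]; norm_num)).1
    exact ⟨this.some.1, this.some.2⟩
  choose p hp using hrep
  have hsymm : ∀ i j, classDegree Γ c (p i) j = classDegree Γ c (p j) i := by
    have h : ∀ i j, (∑ x, if c x = i then classDegree Γ c x j else 0) =
        8 * classDegree Γ c (p i) j := by
      intro i j
      have h8 := natCard_subtype_eq_sum fun x => c x = i
      rw [hclass] at h8
      rw [show (8 : ℤ) = ((8 : ℕ) : ℤ) from rfl, h8, Finset.sum_mul]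
      refine Finset.sum_congr rfl fun x _ => ?_
      by_cases hx : c x = i
      · simp [hx, hequit x (p i) (hx.trans (hp i).symm) j]
      · simp [hx]
    intro i j
    have := sum_classDegree_symm Γ c i j
    rw [h, h] at this
    linarith
  have hauto : ∀ g ∈ H, ∀ x y, c (g x) = c (g y) ↔ c x = c y := by
    intro g hg x y
    by_cases hxy : x = y
    · simp [hxy]
    have hcn : Nat.card {z : V // Γ.Adj (g x) z ∧ Γ.Adj (g y) z} =
        Nat.card {z : V // Γ.Adj x z ∧ Γ.Adj y z} :=
      (Nat.card_congr (g.subtypeEquiv fun z => by rw [hadj g hg, hadj g hg])).symm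
    have hgxy : g x ≠ g y := fun h => hxy (g.injective h)
    constructor
    · intro h
      by_contra hne
      rw [hsame _ _ hgxy h, hdiff _ _ hne] at hcn
      omega
    · intro h
      by_contra hne
      rw [hdiff _ _ hne, hsame _ _ hxy h] at hcn
      omega
  have hdiag : ∀ i j, classDegree Γ c (p i) i = classDegree Γ c (p j) j := by
    intro i j
    obtain ⟨g, ⟨hg, hgp⟩, -⟩ := htrans (p j) (p i)
    have := classDegree_self_map Γ c g (hadj g hg) (hauto g hg) (p j)
    rwa [hgp, hp, hp] at this
  have hrow : ∀ i, _ := fun i =>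
    pairwise_ne_of_sum_six_of_sum_sq_twenty (hnonneg (p i) 0) (hnonneg (p i) 1) (hnonneg (p i) 2)
      (by simpa [Fin.sum_univ_three] using hsum (p i))
      (by simpa [Fin.sum_univ_three] using hmul (p i) (p i))
  have h0 := hrow 0
  have h1 := hrow 1
  have h2 := hrow 2
  have s01 := hsymm 0 1
  have s02 := hsymm 0 2
  have s12 := hsymm 1 2
  have d01 := hdiag 0 1
  have d02 := hdiag 0 2
  omega
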